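/- arXiv:2405.14018 — 2 statements merged into one kernel-verified Lean document; each statement's English description precedes it below -/
import Mathlib

section
/- Let F be a p-dimensional probability distribution with continuous joint density p(x_1,…,x_p), compactly supported in the ball ‖x‖_2 ≤ R. For each coordinate i, let A_i denote either the event {x_i − ⌊x_i⌋ ∈ G} or its complement {x_i − ⌊x_i⌋ ∉ G}, where G is the green list with m intervals. Then as m → ∞, P_{x∼F}(∩_{i=1}^p A_i) → (1/2)^p. -/
open MeasureTheory Set Filter

def greenInterval (m : ℕ) (b : Fin m → Bool) (k : Fin m) : Set ℝ :=
  Set.Icc ((2 * (k : ℝ) + (if b k then 1 else 0)) / (2 * m))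
          ((2 * (k : ℝ) + (if b k then 1 else 0) + 1) / (2 * m))

def greenSet (m : ℕ) (b : Fin m → Bool) : Set ℝ :=
  ⋃ k : Fin m, greenInterval m b k

/-- The involution of `ℝ` exchanging the two halves of every interval `[k / m, (k + 1) / m)`. -/
noncomputable def halfSwap (m : ℕ) (t : ℝ) : ℝ :=
  if Even ⌊2 * m * t⌋ then t + 1 / (2 * m) else t - 1 / (2 * m)

lemma measurableSet_even_floor (m : ℕ) : MeasurableSet {t : ℝ | Even ⌊2 * m * t⌋} := by
  have h : Measurable fun t : ℝ => ⌊2 * m * t⌋ := Int.measurable_floor.comp (by fun_prop)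
  exact h (MeasurableSet.of_discrete (s := {n : ℤ | Even n}))

lemma measurable_halfSwap (m : ℕ) : Measurable (halfSwap m) :=
  Measurable.ite (measurableSet_even_floor m) (by fun_prop) (by fun_prop)

lemma floor_two_mul_add {m : ℕ} (hm : m ≠ 0) (t : ℝ) :
    ⌊2 * m * (t + 1 / (2 * m))⌋ = ⌊2 * m * t⌋ + 1 := by
  have hm' : (m : ℝ) ≠ 0 := by exact_mod_cast hm
  rw [← Int.floor_add_one]
  congr 1
  field_simp

lemma floor_two_mul_sub {m : ℕ} (hm : m ≠ 0) (t : ℝ) :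
    ⌊2 * m * (t - 1 / (2 * m))⌋ = ⌊2 * m * t⌋ - 1 := by
  have hm' : (m : ℝ) ≠ 0 := by exact_mod_cast hm
  rw [← Int.floor_sub_one]
  congr 1
  field_simp

lemma measurePreserving_halfSwap {m : ℕ} (hm : m ≠ 0) :
    MeasurePreserving (halfSwap m) := by
  refine ⟨measurable_halfSwap m, Measure.ext fun S hS => ?_⟩
  rw [Measure.map_apply (measurable_halfSwap m) hS]
  have hV := measurableSet_even_floor m
  set V : Set ℝ := {t : ℝ | Even ⌊2 * m * t⌋} with hVdef
  rw [← measure_inter_add_sdiff (halfSwap m ⁻¹' S) hV, ← measure_inter_add_sdiff S hV, add_comm]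
  congr 1
  · have h : halfSwap m ⁻¹' S \ V = (fun t => t + -(1 / (2 * m : ℝ))) ⁻¹' (S ∩ V) := by
      ext t
      simp only [Set.mem_sdiff, mem_preimage, mem_inter_iff, hVdef, mem_ofPred_eq, ← sub_eq_add_neg,
        floor_two_mul_sub hm, Int.even_sub_one, halfSwap]
      refine and_congr_left fun ht => ?_
      rw [if_neg ht]
    rw [h, measure_preimage_add_right]
  · have h : halfSwap m ⁻¹' S ∩ V = (fun t => t + (1 / (2 * m : ℝ))) ⁻¹' (S \ V) := by
      ext t
      simp only [Set.mem_sdiff, mem_preimage, mem_inter_iff, hVdef, mem_ofPred_eq,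
        floor_two_mul_add hm, Int.even_add_one, not_not, halfSwap]
      refine and_congr_left fun ht => ?_
      rw [if_pos ht]
    rw [h, measure_preimage_add_right]

lemma abs_halfSwap_sub (m : ℕ) (t : ℝ) : |halfSwap m t - t| = 1 / (2 * m) := by
  have h : (0 : ℝ) ≤ 1 / (2 * m) := by positivity
  unfold halfSwap
  split_ifs
  · rw [add_sub_cancel_left, abs_of_nonneg h]
  · rw [sub_sub_cancel_left, abs_neg, abs_of_nonneg h]

lemma floor_two_mul_emod {m : ℕ} (hm : m ≠ 0) (t : ℝ) :
    ⌊2 * m * t⌋ % (2 * m) = ⌊2 * m * Int.fract t⌋ := by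
  have hm' : (0 : ℝ) < m := by exact_mod_cast Nat.pos_of_ne_zero hm
  have h : 2 * (m : ℝ) * t = 2 * m * Int.fract t + ((2 * m * ⌊t⌋ : ℤ) : ℝ) := by
    push_cast
    rw [← mul_add, Int.fract_add_floor]
  rw [h, Int.floor_add_intCast, Int.add_mul_emod_self_left]
  refine Int.emod_eq_of_lt (Int.floor_nonneg.2 ?_) (Int.floor_lt.2 ?_)
  · have := Int.fract_nonneg t
    positivity
  · push_cast
    have := Int.fract_lt_one t
    nlinarith

lemma mem_greenInterval_iff {m : ℕ} (b : Fin m → Bool) (k : Fin m) {t : ℝ}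
    (ht : ∀ n : ℤ, 2 * m * t ≠ n) :
    t ∈ greenInterval m b k ↔ ⌊2 * m * t⌋ = 2 * (k : ℤ) + (if b k then 1 else 0) := by
  have hm' : (0 : ℝ) < 2 * m := by
    have : (0 : ℝ) < m := by exact_mod_cast k.pos
    positivity
  have hc : (2 * (k : ℝ) + (if b k then 1 else 0)) =
      ((2 * (k : ℤ) + (if b k then 1 else 0) : ℤ) : ℝ) := by
    split_ifs <;> push_cast <;> rfl
  rw [greenInterval, mem_Icc, div_le_iff₀ hm', le_div_iff₀ hm', hc, Int.floor_eq_iff,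
    mul_comm t]
  refine and_congr_right fun _ => ⟨fun h => lt_of_le_of_ne h ?_, le_of_lt⟩
  exact_mod_cast ht _

lemma fract_mem_greenSet_iff {m : ℕ} (b : Fin m → Bool) {t : ℝ}
    (ht : ∀ n : ℤ, 2 * m * t ≠ n) :
    Int.fract t ∈ greenSet m b ↔
      ∃ k : Fin m, ⌊2 * m * t⌋ % (2 * m) = 2 * (k : ℤ) + (if b k then 1 else 0) := by
  have ht' : ∀ n : ℤ, 2 * m * Int.fract t ≠ n := by
    intro n hn
    apply ht (n + 2 * m * ⌊t⌋)
    push_cast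
    rw [← hn, ← mul_add, Int.fract_add_floor]
  rw [greenSet, mem_iUnion]
  refine exists_congr fun k => ?_
  rw [mem_greenInterval_iff b k ht', floor_two_mul_emod k.pos.ne']

lemma exists_add_one_emod_eq_iff {m : ℕ} (hm : m ≠ 0) (b : Fin m → Bool) {n : ℤ} (hn : Even n) :
    (∃ k : Fin m, (n + 1) % (2 * m) = 2 * (k : ℤ) + (if b k then 1 else 0)) ↔
      ¬ ∃ k : Fin m, n % (2 * m) = 2 * (k : ℤ) + (if b k then 1 else 0) := by
  obtain ⟨q, rfl⟩ := hn
  have hm' : (0 : ℤ) < m := by exact_mod_cast Nat.pos_of_ne_zero hm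
  have hr0 : 0 ≤ q % m := Int.emod_nonneg _ hm'.ne'
  have hr1 : q % m < m := Int.emod_lt_of_pos _ hm'
  have h0 : (q + q) % (2 * m) = 2 * (q % m) := by
    rw [← two_mul, Int.mul_emod_mul_of_pos _ _ two_pos]
  have h1 : (q + q + 1) % (2 * m) = 2 * (q % m) + 1 := by
    have h : q + q + 1 = 2 * (q % m) + 1 + 2 * m * (q / m) := by
      have := Int.emod_add_mul_ediv q m
      linear_combination (-2) * this
    rw [h, Int.add_mul_emod_self_left]
    exact Int.emod_eq_of_lt (by omega) (by omega)
  rw [h0, h1]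
  generalize q % m = r at hr0 hr1
  lift r to ℕ using hr0
  have hr : r < m := by exact_mod_cast hr1
  have e : ∀ k : Fin m, (k : ℕ) = r ↔ k = ⟨r, hr⟩ := fun k => by rw [Fin.ext_iff]
  have hodd : (∃ k : Fin m, 2 * (r : ℤ) + 1 = 2 * (k : ℤ) + (if b k then 1 else 0)) ↔
      b ⟨r, hr⟩ = true := by
    constructor
    · rintro ⟨k, hk⟩
      split_ifs at hk with hb
      · rwa [← (e k).1 (by omega)]
      · omega
    · intro h
      exact ⟨⟨r, hr⟩, by simp [h]⟩
  have heven : (∃ k : Fin m, 2 * (r : ℤ) = 2 * (k : ℤ) + (if b k then 1 else 0)) ↔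
      ¬ b ⟨r, hr⟩ = true := by
    constructor
    · rintro ⟨k, hk⟩
      split_ifs at hk with hb
      · omega
      · rwa [← (e k).1 (by omega)]
    · intro h
      exact ⟨⟨r, hr⟩, by simp [h]⟩
  rw [hodd, heven, not_not]

lemma fract_halfSwap_mem_greenSet_iff {m : ℕ} (hm : m ≠ 0) (b : Fin m → Bool) {t : ℝ}
    (ht : ∀ n : ℤ, 2 * m * t ≠ n) :
    Int.fract (halfSwap m t) ∈ greenSet m b ↔ Int.fract t ∉ greenSet m b := by
  have hm' : (m : ℝ) ≠ 0 := by exact_mod_cast hm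
  have ht' : ∀ n : ℤ, 2 * m * halfSwap m t ≠ n := by
    intro n hn
    unfold halfSwap at hn
    split_ifs at hn
    · apply ht (n - 1)
      push_cast
      rw [← hn]
      field_simp
      ring
    · apply ht (n + 1)
      push_cast
      rw [← hn]
      field_simp
      ring
  rw [fract_mem_greenSet_iff b ht, fract_mem_greenSet_iff b ht']
  by_cases hV : Even ⌊2 * m * t⌋
  · rw [halfSwap, if_pos hV, floor_two_mul_add hm]
    exact exists_add_one_emod_eq_iff hm b hV
  · rw [halfSwap, if_neg hV, floor_two_mul_sub hm]
    have h := exists_add_one_emod_eq_iff hm b (Int.even_sub_one.2 hV)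
    rw [sub_add_cancel] at h
    rw [h, not_not]

lemma ae_two_mul_ne_intCast {m : ℕ} (hm : m ≠ 0) : ∀ᵐ t : ℝ, ∀ n : ℤ, 2 * m * t ≠ n := by
  have hm' : (m : ℝ) ≠ 0 := by exact_mod_cast hm
  rw [ae_all_iff]
  intro n
  filter_upwards [Measure.ae_ne volume ((n : ℝ) / (2 * m))] with t ht h
  apply ht
  rw [← h]
  field_simp

/-- The points whose fractional parts realise the green/red pattern `s`. -/
def patternSet {p : ℕ} (m : ℕ) (b : Fin m → Bool) (s : Fin p → Bool) : Set (Fin p → ℝ) :=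
  {x | ∀ i, (Int.fract (x i) ∈ greenSet m b ↔ s i = true)}

lemma measurableSet_patternSet {p : ℕ} (m : ℕ) (b : Fin m → Bool) (s : Fin p → Bool) :
    MeasurableSet (patternSet m b s) := by
  have hG : MeasurableSet (greenSet m b) := MeasurableSet.iUnion fun _ => measurableSet_Icc
  refine MeasurableSet.congr ?_ (ofPred_forall _).symm
  refine MeasurableSet.iInter fun i => ?_
  have h : MeasurableSet {x : Fin p → ℝ | Int.fract (x i) ∈ greenSet m b} :=
    (measurable_fract.comp (measurable_pi_apply i)) hG
  by_cases hs : s i = true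
  · simpa only [hs, iff_true] using h
  · simp only [hs, Bool.false_eq_true, iff_false]
    exact h.compl

lemma sum_indicator_patternSet {p : ℕ} (m : ℕ) (b : Fin m → Bool) (f : (Fin p → ℝ) → ℝ)
    (x : Fin p → ℝ) : ∑ s : Fin p → Bool, (patternSet m b s).indicator f x = f x := by
  classical
  have h : ∀ s : Fin p → Bool, x ∈ patternSet m b s ↔
      s = fun i => decide (Int.fract (x i) ∈ greenSet m b) := by
    intro s
    rw [funext_iff]
    refine forall_congr' fun i => ?_
    cases s i <;> simp
  simp only [indicator_apply, h, Finset.sum_ite_eq', Finset.mem_univ, if_true]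

lemma sum_setIntegral_patternSet {p : ℕ} (m : ℕ) (b : Fin m → Bool) {f : (Fin p → ℝ) → ℝ}
    (hf : Integrable f) : ∑ s : Fin p → Bool, ∫ x in patternSet m b s, f x = ∫ x, f x := by
  simp_rw [← integral_indicator (measurableSet_patternSet m b _)]
  rw [← integral_finsetSum _ fun s _ => hf.indicator (measurableSet_patternSet m b s)]
  simp_rw [sum_indicator_patternSet]

/-- Apply `halfSwap m` in the coordinates selected by `c`. -/
noncomputable def coordSwap {p : ℕ} (m : ℕ) (c : Fin p → Bool) (x : Fin p → ℝ) : Fin p → ℝ :=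
  fun i => (if c i then halfSwap m else id) (x i)

lemma measurePreserving_coordSwap {p m : ℕ} (hm : m ≠ 0) (c : Fin p → Bool) :
    MeasurePreserving (coordSwap m c) := by
  refine volume_preserving_pi fun i => ?_
  split_ifs
  · exact measurePreserving_halfSwap hm
  · exact MeasurePreserving.id _

lemma dist_coordSwap_le {p : ℕ} (m : ℕ) (c : Fin p → Bool) (x : Fin p → ℝ) :
    dist (coordSwap m c x) x ≤ 1 / (2 * m) := by
  refine (dist_pi_le_iff (by positivity)).2 fun i => ?_
  unfold coordSwap
  split_ifs
  · exact (abs_halfSwap_sub m (x i)).le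
  · rw [id, dist_self]
    positivity

lemma preimage_coordSwap_patternSet {p m : ℕ} (hm : m ≠ 0) (b : Fin m → Bool)
    (s s' : Fin p → Bool) :
    coordSwap m (fun i => s i ^^ s' i) ⁻¹' patternSet m b s =ᵐ[volume] patternSet m b s' := by
  have h : ∀ᵐ x : Fin p → ℝ, ∀ i, ∀ n : ℤ, 2 * m * x i ≠ n := by
    rw [ae_all_iff]
    intro i
    exact (Measure.quasiMeasurePreserving_eval (fun _ : Fin p => (volume : Measure ℝ)) i).ae
      (ae_two_mul_ne_intCast hm)
  rw [eventuallyEq_set]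
  filter_upwards [h] with x hx
  refine forall_congr' fun i => ?_
  have := fract_halfSwap_mem_greenSet_iff hm b (hx i)
  unfold coordSwap
  beta_reduce
  generalize s i = u
  generalize s' i = v
  cases u <;> cases v <;> simp [this]

lemma tendsto_integral_norm_comp_coordSwap_sub {p : ℕ} {f : (Fin p → ℝ) → ℝ} (hf : Continuous f)
    (hfc : HasCompactSupport f) (c : Fin p → Bool) :
    Tendsto (fun m : ℕ => ∫ x, ‖f (coordSwap m c x) - f x‖) atTop (nhds 0) := by
  obtain ⟨M, hM⟩ := hfc.exists_bound_of_continuous hf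
  obtain ⟨r, hr⟩ := hfc.isCompact.isBounded.subset_closedBall 0
  have hzero : ∀ x, r < ‖x‖ → f x = 0 := by
    intro x hx
    by_contra h
    have := hr (subset_tsupport f h)
    rw [mem_closedBall_zero_iff] at this
    linarith
  have hdist : ∀ x : Fin p → ℝ, Tendsto (fun m : ℕ => coordSwap m c x) atTop (nhds x) := by
    intro x
    rw [tendsto_iff_dist_tendsto_zero]
    refine squeeze_zero (fun _ => dist_nonneg) (fun m => dist_coordSwap_le m c x) ?_
    have h := (tendsto_one_div_atTop_nhds_zero_nat (𝕜 := ℝ)).const_mul (1 / 2)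
    rw [mul_zero] at h
    refine h.congr fun m => ?_
    rw [one_div_mul_one_div]
  rw [← integral_zero (Fin p → ℝ) ℝ (μ := volume)]
  refine tendsto_integral_filter_of_dominated_convergence
    ((Metric.closedBall (0 : Fin p → ℝ) (r + 1)).indicator fun _ => M + M) ?_ ?_ ?_ ?_
  · filter_upwards [eventually_ne_atTop 0] with m hm
    exact ((hf.measurable.comp (measurePreserving_coordSwap hm c).measurable).sub
      hf.measurable).norm.aestronglyMeasurable
  · filter_upwards [eventually_ge_atTop 1] with m hm
    refine ae_of_all _ fun x => ?_
    rw [norm_norm]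
    by_cases hx : x ∈ Metric.closedBall (0 : Fin p → ℝ) (r + 1)
    · rw [indicator_of_mem hx]
      exact (norm_sub_le _ _).trans (add_le_add (hM _) (hM _))
    · rw [indicator_of_notMem hx]
      rw [mem_closedBall_zero_iff, not_le] at hx
      have hm' : (1 : ℝ) ≤ m := by exact_mod_cast hm
      have h1 : (1 : ℝ) / (2 * m) ≤ 1 := by
        rw [div_le_one (by positivity)]
        linarith
      have h2 : ‖x‖ ≤ ‖coordSwap m c x‖ + dist (coordSwap m c x) x := by
        rw [dist_comm, dist_eq_norm]
        exact norm_le_norm_add_norm_sub' x _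
      have h3 := dist_coordSwap_le m c x
      rw [hzero x (by linarith), hzero (coordSwap m c x) (by linarith), sub_zero, norm_zero]
  · rw [integrable_indicator_iff measurableSet_closedBall]
    exact integrableOn_const measure_closedBall_lt_top.ne
  · refine ae_of_all _ fun x => ?_
    have h := (((hf.tendsto x).comp (hdist x)).sub_const (f x)).norm
    rwa [sub_self, norm_zero] at h

lemma tendsto_setIntegral_patternSet_sub {p : ℕ} {f : (Fin p → ℝ) → ℝ} (hf : Continuous f)
    (hfc : HasCompactSupport f) (b : ∀ m : ℕ, Fin m → Bool) (s s' : Fin p → Bool) :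
    Tendsto (fun m : ℕ => (∫ x in patternSet m (b m) s, f x) -
      ∫ x in patternSet m (b m) s', f x) atTop (nhds 0) := by
  refine squeeze_zero_norm' ?_
    (tendsto_integral_norm_comp_coordSwap_sub hf hfc fun i => s i ^^ s' i)
  filter_upwards [eventually_ne_atTop 0] with m hm
  have hint : Integrable f := hf.integrable_of_hasCompactSupport hfc
  have hT := measurePreserving_coordSwap hm fun i => s i ^^ s' i
  set T := coordSwap m fun i => s i ^^ s' i
  have hcomp : Integrable fun x => f (T x) := hT.integrable_comp_of_integrable hint
  have h : ∫ x in patternSet m (b m) s, f x = ∫ x in patternSet m (b m) s', f (T x) := by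
    rw [← setIntegral_congr_set (preimage_coordSwap_patternSet hm (b m) s s')]
    nth_rewrite 1 [← hT.map_eq]
    exact setIntegral_map (measurableSet_patternSet m (b m) s)
      hf.aestronglyMeasurable hT.measurable.aemeasurable
  rw [h, ← integral_sub hcomp.integrableOn hint.integrableOn]
  refine (norm_integral_le_integral_norm _).trans ?_
  exact setIntegral_le_integral (hcomp.sub hint).norm (ae_of_all _ fun _ => norm_nonneg _)

lemma tendsto_setIntegral_patternSet {p : ℕ} {f : (Fin p → ℝ) → ℝ} (hf : Continuous f)
    (hfc : HasCompactSupport f) (b : ∀ m : ℕ, Fin m → Bool) (s : Fin p → Bool) :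
    Tendsto (fun m : ℕ => ∫ x in patternSet m (b m) s, f x) atTop
      (nhds ((1 / 2 : ℝ) ^ p * ∫ x, f x)) := by
  have hint : Integrable f := hf.integrable_of_hasCompactSupport hfc
  have h := tendsto_finsetSum (Finset.univ : Finset (Fin p → Bool)) fun s' _ =>
    tendsto_setIntegral_patternSet_sub hf hfc b s s'
  have h' := (h.add_const (∫ x, f x)).const_mul ((1 / 2 : ℝ) ^ p)
  rw [Finset.sum_const_zero, zero_add] at h'
  refine h'.congr fun m => ?_
  rw [Finset.sum_sub_distrib, sum_setIntegral_patternSet m (b m) hint, sub_add_cancel,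
    Finset.sum_const, Finset.card_univ, Fintype.card_fun, Fintype.card_bool, Fintype.card_fin,
    nsmul_eq_mul, ← mul_assoc]
  push_cast
  rw [← mul_pow]
  norm_num

/-- **Asymptotic independence (compactly supported case).** For a `p`-dimensional
distribution with continuous density supported in the Euclidean ball of radius `R`, the
probability that each coordinate's fractional part lies in (`s i = true`) or outside
(`s i = false`) the green list converges to `(1/2)^p` as `m → ∞`, for any choice sequence
of green lists. -/
theorem asymptotic_independence_compact (p : ℕ) (R : ℝ)
    (f : (Fin p → ℝ) → ℝ) (hf_cont : Continuous f) (hf_nonneg : ∀ x, 0 ≤ f x)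
    (hf_int : ∫ x, f x = 1)
    (hf_supp : ∀ x : Fin p → ℝ, f x ≠ 0 → Real.sqrt (∑ i, (x i) ^ 2) ≤ R)
    (b : ∀ m : ℕ, Fin m → Bool) (s : Fin p → Bool) :
    Tendsto (fun m : ℕ =>
      (((volume : Measure (Fin p → ℝ)).withDensity fun x => ENNReal.ofReal (f x))
        {x : Fin p → ℝ | ∀ i, (Int.fract (x i) ∈ greenSet m (b m) ↔ s i = true)}).toReal)
      atTop (nhds ((1 / 2 : ℝ) ^ p)) := by
  have hfc : HasCompactSupport f := by
    refine HasCompactSupport.of_support_subset_isCompact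
      (isCompact_closedBall (0 : Fin p → ℝ) R) fun x hx => ?_
    have hR := hf_supp x hx
    rw [mem_closedBall_zero_iff, pi_norm_le_iff_of_nonneg ((Real.sqrt_nonneg _).trans hR)]
    intro i
    refine le_trans (Real.abs_le_sqrt ?_) hR
    exact Finset.single_le_sum (f := fun j => x j ^ 2) (fun j _ => sq_nonneg _) (Finset.mem_univ i)
  have h := tendsto_setIntegral_patternSet hf_cont hfc b s
  rw [hf_int, mul_one] at h
  refine h.congr fun m => ?_
  have hE := measurableSet_patternSet m (b m) s
  rw [integral_eq_lintegral_of_nonneg_ae (ae_of_all _ hf_nonneg) hf_cont.aestronglyMeasurable,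
    ← withDensity_apply _ hE, patternSet]
end

section
/- Suppose T_1, …, T_p are i.i.d. Binomial(n, 1/2) random variables. If p = p(n) satisfies p = o(n^{2/7}) as n → ∞, then the statistic ∑_{j=1}^{p} [2√n (T_j/n − 1/2)]^2 converges in distribution to χ²_p, in the sense that sup_{r ≥ 0} |P(∑_{j=1}^p [2√n(T_j/n − 1/2)]² ≤ r) − P(χ²_p ≤ r)| → 0, even as p → ∞. -/
open MeasureTheory ProbabilityTheory Filter

/-- The chi-squared measure with `p` degrees of freedom: the law of `‖Z‖₂²` for a
standard `p`-dimensional Gaussian `Z`. -/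
noncomputable def chiSqMeasure (p : ℕ) : Measure ℝ :=
  Measure.map (fun z : Fin p → ℝ => ∑ i, (z i) ^ 2)
    (Measure.pi fun _ : Fin p => gaussianReal 0 1)

/-- The joint law of `p` i.i.d. `Binomial(n, 1/2)` random variables. -/
noncomputable def binomialPi (n p : ℕ) : Measure (Fin p → Fin (n + 1)) :=
  Measure.pi fun _ : Fin p => (PMF.binomial 2⁻¹ (by norm_num) n).toMeasure

/-- **Pólya's theorem**: pointwise convergence of distribution functions to a continuous one is
uniform. -/
lemma tendstoUniformly_of_monotone_of_continuous {G : ℕ → ℝ → ℝ} {F : ℝ → ℝ}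
    (hG : ∀ k, Monotone (G k)) (hG0 : ∀ k x, 0 ≤ G k x) (hG1 : ∀ k x, G k x ≤ 1)
    (hF : Monotone F) (hFc : Continuous F) (hF0 : Tendsto F atBot (nhds 0))
    (hF1 : Tendsto F atTop (nhds 1)) (h : ∀ x, Tendsto (fun k => G k x) atTop (nhds (F x))) :
    TendstoUniformly G F atTop := by
  rw [Metric.tendstoUniformly_iff]
  intro ε hε
  obtain ⟨N, hN⟩ := exists_nat_gt (4 / ε)
  have hNpos : (0 : ℝ) < N := lt_trans (by positivity) hN
  have hNε : 4 < ε * N := by rwa [div_lt_iff₀' hε] at hN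
  have hq : ∀ m : ℕ, 0 < m → m < N → ∃ x, F x = m / N := by
    intro m h0 h1
    have h0' : (0 : ℝ) < m / N := by positivity
    have h1' : (m / N : ℝ) < 1 := by rw [div_lt_one hNpos]; exact_mod_cast h1
    obtain ⟨a, ha⟩ := (hF0.eventually_lt_const h0').exists
    obtain ⟨b, hb⟩ := (hF1.eventually_const_lt h1').exists
    exact mem_range_of_exists_le_of_exists_ge hFc ⟨a, ha.le⟩ ⟨b, hb.le⟩
  choose! x hx using hq
  have hev : ∀ᶠ k in atTop, ∀ m ∈ Finset.range N, dist (G k (x m)) (F (x m)) < ε / 4 := by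
    rw [Filter.eventually_all_finset]
    intro m _
    exact (Metric.tendsto_nhds.1 (h (x m))) _ (by positivity)
  filter_upwards [hev] with k hk y
  have hF0' : 0 ≤ F y := hF.le_of_tendsto hF0 y
  have hF1' : F y ≤ 1 := hF.ge_of_tendsto hF1 y
  have hfl := Nat.floor_le (mul_nonneg hNpos.le hF0')
  have hlt := Nat.lt_floor_add_one (N * F y)
  set j := ⌊N * F y⌋₊ with hj
  have hjN : j ≤ N := by
    have : (j : ℝ) ≤ N := hfl.trans (by nlinarith)
    exact_mod_cast this
  clear_value j
  rw [Real.dist_eq, abs_sub_lt_iff]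
  constructor
  · by_cases hj2 : 2 ≤ j
    · obtain ⟨m, rfl : j = m + 1⟩ : ∃ m, j = m + 1 := ⟨j - 1, by omega⟩
      have hxm := hx m (by omega) (by omega)
      have hkm := hk m (Finset.mem_range.2 (by omega))
      rw [Real.dist_eq, abs_sub_lt_iff, hxm] at hkm
      push_cast at *
      have hle : x m ≤ y := by
        by_contra! hc
        have := hF hc.le
        rw [hxm, le_div_iff₀ hNpos] at this
        nlinarith
      have h1 := hG k hle
      have h2 : F y ≤ m / N + ε / 2 := by
        rw [← sub_le_iff_le_add', ]
        rw [← mul_le_mul_iff_right₀ hNpos, mul_sub, mul_div_cancel₀ _ hNpos.ne']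
        nlinarith
      linarith [hkm.2]
    · have : (j : ℝ) ≤ 1 := by exact_mod_cast (by omega : j ≤ 1)
      have : F y < ε := by nlinarith
      linarith [hG0 k y]
  · by_cases hj2 : j + 1 < N
    · have hxm := hx (j + 1) (by omega) hj2
      have hkm := hk (j + 1) (Finset.mem_range.2 hj2)
      rw [Real.dist_eq, abs_sub_lt_iff, hxm] at hkm
      push_cast at *
      have hle : y ≤ x (j + 1) := by
        by_contra! hc
        have := hF hc.le
        rw [hxm, div_le_iff₀ hNpos] at this
        nlinarith
      have h1 := hG k hle
      have h2 : (j + 1 : ℝ) / N ≤ F y + ε / 2 := by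
        rw [div_le_iff₀ hNpos]
        nlinarith
      linarith [hkm.1]
    · have : (N : ℝ) ≤ j + 1 := by exact_mod_cast (by omega : N ≤ j + 1)
      have : 1 - ε < F y := by nlinarith
      linarith [hG1 k y]

lemma tendstoUniformly_cdf {μ : ℕ → ProbabilityMeasure ℝ} {ν : ProbabilityMeasure ℝ}
    [hν : NullSingletonClass (ν : Measure ℝ)] (h : Tendsto μ atTop (nhds ν)) :
    TendstoUniformly (fun k => (cdf (μ k : Measure ℝ) : ℝ → ℝ)) (cdf (ν : Measure ℝ)) atTop := by
  refine tendstoUniformly_of_monotone_of_continuous (fun k => monotone_cdf _)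
    (fun k => cdf_nonneg _) (fun k => cdf_le_one _) (monotone_cdf _) ?_ (tendsto_cdf_atBot _)
    (tendsto_cdf_atTop _) fun x => ?_
  · rw [continuous_iff_continuousAt]
    intro x
    have h0 : (cdf (ν : Measure ℝ)).measure {x} = 0 := by rw [measure_cdf]; simp
    rw [StieltjesFunction.measure_singleton, ENNReal.ofReal_eq_zero, sub_nonpos] at h0
    rw [(monotone_cdf _).continuousAt_iff_leftLim_eq_rightLim, StieltjesFunction.rightLim_eq]
    exact le_antisymm ((monotone_cdf _).leftLim_le le_rfl) h0
  · simp only [cdf_eq_real, Measure.real]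
    refine (ENNReal.tendsto_toReal (measure_ne_top _ _)).comp ?_
    exact ProbabilityMeasure.tendsto_measure_of_null_frontier_of_tendsto' h (by simp)

lemma norm_pow_sub_pow_le_mul {z w : ℂ} (hz : ‖z‖ ≤ 1) (hw : ‖w‖ ≤ 1) (n : ℕ) :
    ‖z ^ n - w ^ n‖ ≤ n * ‖z - w‖ := by
  induction n with
  | zero => simp
  | succ n ih =>
    have : z ^ (n + 1) - w ^ (n + 1) = z ^ n * (z - w) + (z ^ n - w ^ n) * w := by ring
    rw [this]
    refine (norm_add_le _ _).trans ?_
    rw [norm_mul, norm_mul, norm_pow]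
    have h1 : ‖z‖ ^ n ≤ 1 := pow_le_one₀ (norm_nonneg _) hz
    have h2 := mul_le_mul_of_nonneg_right h1 (norm_nonneg (z - w))
    have h3 := mul_le_mul ih hw (norm_nonneg _) (by positivity)
    push_cast
    linarith

lemma norm_cexp_mul_I_sub_le (x : ℝ) :
    ‖Complex.exp (x * Complex.I) - (1 + x * Complex.I - x ^ 2 / 2)‖ ≤ 4 * |x| ^ 3 := by
  rcases le_or_gt |x| 1 with hx | hx
  · have h := Complex.exp_bound (x := x * Complex.I) (by simpa using hx) (n := 3) (by norm_num)
    simp only [Finset.sum_range_succ, Finset.sum_range_zero, mul_pow, Complex.I_sq] at h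
    norm_num [Nat.factorial] at h
    have e : Complex.exp (x * Complex.I) - (1 + x * Complex.I - x ^ 2 / 2)
      = Complex.exp (x * Complex.I) - (1 + x * Complex.I + -(x : ℂ) ^ 2 / 2) := by ring
    rw [e]
    refine h.trans ?_
    have : 0 ≤ |x| ^ 3 := by positivity
    linarith
  · have h1 : ‖Complex.exp (x * Complex.I)‖ = 1 := Complex.norm_exp_ofReal_mul_I x
    refine (norm_sub_le _ _).trans ?_
    have h2 : ‖(1 + x * Complex.I - x ^ 2 / 2 : ℂ)‖ ≤ 1 + |x| + |x| ^ 2 / 2 := by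
      refine (norm_sub_le _ _).trans ?_
      refine add_le_add ((norm_add_le _ _).trans ?_) ?_ <;> simp
    rw [h1]
    have h3 : |x| ≤ |x| ^ 3 := le_self_pow₀ hx.le (by norm_num)
    have h4 : |x| ^ 2 ≤ |x| ^ 3 := pow_le_pow_right₀ hx.le (by norm_num)
    linarith

lemma norm_charFun_sub_le {μ : Measure ℝ} [IsProbabilityMeasure μ]
    (h3 : Integrable (fun x : ℝ => |x| ^ 3) μ) (h0 : ∫ x, x ∂μ = 0) (s : ℝ) :
    ‖charFun μ s - (1 - s ^ 2 * (∫ x, x ^ 2 ∂μ : ℝ) / 2)‖ ≤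
      4 * |s| ^ 3 * ∫ x, |x| ^ 3 ∂μ := by
  have hL : MemLp (id : ℝ → ℝ) 3 μ := by
    rw [← integrable_norm_rpow_iff (by fun_prop) (by norm_num) (by norm_num)]
    convert h3 using 2 with x
    rw [← Real.rpow_natCast]
    norm_num
  have h1 : Integrable (fun x : ℝ => x) μ := hL.integrable (by norm_num)
  have h2 : Integrable (fun x : ℝ => x ^ 2) μ :=
    (hL.mono_exponent (p := 2) (by norm_num)).integrable_sq
  have hexp : Integrable (fun x : ℝ => Complex.exp (s * x * Complex.I)) μ := by
    refine (integrable_const (1 : ℝ)).mono' (by fun_prop) (ae_of_all _ fun x => ?_)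
    rw [← Complex.ofReal_mul, Complex.norm_exp_ofReal_mul_I]
  have e : charFun μ s - (1 - s ^ 2 * (∫ x, x ^ 2 ∂μ : ℝ) / 2) =
      ∫ x : ℝ, (Complex.exp ((s * x : ℝ) * Complex.I) -
        (1 + (s * x : ℝ) * Complex.I - (s * x : ℝ) ^ 2 / 2)) ∂μ := by
    have i1 : Integrable (fun x : ℝ => ((x : ℝ) : ℂ)) μ := h1.ofReal
    have i2 : Integrable (fun x : ℝ => ((x ^ 2 : ℝ) : ℂ)) μ := h2.ofReal
    have : ∀ x : ℝ, (Complex.exp ((s * x : ℝ) * Complex.I) -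
        (1 + (s * x : ℝ) * Complex.I - (s * x : ℝ) ^ 2 / 2)) =
        Complex.exp (s * x * Complex.I) -
        (1 + s * Complex.I * (x : ℂ) - s ^ 2 / 2 * ((x ^ 2 : ℝ) : ℂ)) := by
      intro x; push_cast; ring
    simp_rw [this]
    rw [integral_sub hexp, integral_sub, integral_add, integral_const_mul, integral_const_mul,
      integral_complex_ofReal, integral_complex_ofReal, h0, ← charFun_apply_real]
    · simp; ring
    · exact integrable_const _
    · exact i1.const_mul _
    · exact (integrable_const _).add (i1.const_mul _)
    · exact i2.const_mul _
    · exact ((integrable_const _).add (i1.const_mul _)).sub (i2.const_mul _)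
  rw [e, ← integral_const_mul]
  refine norm_integral_le_of_norm_le (h3.const_mul _) (ae_of_all _ fun x => ?_)
  refine (norm_cexp_mul_I_sub_le _).trans (le_of_eq ?_)
  rw [abs_mul]; ring

lemma tendsto_charFun_pow_of_thirdMoment_le {μ : ℕ → Measure ℝ} [∀ k, IsProbabilityMeasure (μ k)]
    {q : ℕ → ℕ} {v : ℝ} {M : ℝ} (hq : Tendsto q atTop atTop)
    (h3 : ∀ k, Integrable (fun x : ℝ => |x| ^ 3) (μ k)) (hM : ∀ k, ∫ x, |x| ^ 3 ∂(μ k) ≤ M)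
    (h0 : ∀ k, ∫ x, x ∂(μ k) = 0) (hv0 : 0 ≤ v)
    (hv : Tendsto (fun k => ∫ x, x ^ 2 ∂(μ k)) atTop (nhds v)) (t : ℝ) :
    Tendsto (fun k => charFun (μ k) ((√(q k))⁻¹ * t) ^ (q k)) atTop
      (nhds ((Real.exp (-(v * t ^ 2 / 2)) : ℝ) : ℂ)) := by
  rw [tendsto_iff_norm_sub_tendsto_zero]
  have hqR : Tendsto (fun k => (q k : ℝ)) atTop atTop := tendsto_natCast_atTop_atTop.comp hq
  set c : ℝ := v * t ^ 2 / 2 with hc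
  have hc0 : 0 ≤ c := by positivity
  have lim : Tendsto (fun k => 4 * M * |t| ^ 3 * (√(q k))⁻¹ +
      |(∫ x, x ^ 2 ∂(μ k)) - v| * (t ^ 2 / 2) + c ^ 2 * (q k : ℝ)⁻¹) atTop (nhds 0) := by
    have l1 : Tendsto (fun k => (√(q k))⁻¹) atTop (nhds 0) :=
      tendsto_inv_atTop_zero.comp (Real.tendsto_sqrt_atTop.comp hqR)
    have l2 : Tendsto (fun k => |(∫ x, x ^ 2 ∂(μ k)) - v|) atTop (nhds 0) := by
      simpa using (hv.sub_const v).abs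
    have l3 : Tendsto (fun k => (q k : ℝ)⁻¹) atTop (nhds 0) := tendsto_inv_atTop_zero.comp hqR
    simpa using ((l1.const_mul (4 * M * |t| ^ 3)).add (l2.mul_const (t ^ 2 / 2))).add
      (l3.const_mul (c ^ 2))
  refine squeeze_zero' (Eventually.of_forall fun k => norm_nonneg _) ?_ lim
  filter_upwards [hqR.eventually_ge_atTop (max 1 c)] with k hk
  have hq1 : (1 : ℝ) ≤ q k := (le_max_left _ _).trans hk
  have hqc : c ≤ q k := (le_max_right _ _).trans hk
  have hqpos : (0 : ℝ) < q k := by linarith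
  have hsq : 0 < √(q k : ℝ) := Real.sqrt_pos.2 hqpos
  have hss : √(q k : ℝ) ^ 2 = q k := Real.sq_sqrt hqpos.le
  set r := √(q k : ℝ) with hr
  set φ := charFun (μ k) (r⁻¹ * t)
  set w : ℝ := Real.exp (-(c / q k))
  have hw : ((Real.exp (-(v * t ^ 2 / 2)) : ℝ) : ℂ) = (w : ℂ) ^ (q k) := by
    have : (q k : ℝ) * -(c / q k) = -c := by field_simp
    rw [← Complex.ofReal_pow, ← Real.exp_nat_mul, this]
  rw [hw]
  have hw1 : ‖(w : ℂ)‖ ≤ 1 := by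
    rw [Complex.norm_real, Real.norm_of_nonneg (Real.exp_pos _).le, Real.exp_le_one_iff]
    have := div_nonneg hc0 hqpos.le
    linarith
  refine (norm_pow_sub_pow_le_mul (norm_charFun_le_one _) hw1 _).trans ?_
  set m2 := ∫ x, x ^ 2 ∂(μ k)
  have b1 : ‖φ - (1 - ((r⁻¹ * t : ℝ) : ℂ) ^ 2 * (m2 : ℝ) / 2)‖ ≤ 4 * |r⁻¹ * t| ^ 3 * M :=
    (norm_charFun_sub_le (h3 k) (h0 k) _).trans
      (mul_le_mul_of_nonneg_left (hM k) (by positivity))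
  have b2 : |(1 - (r⁻¹ * t) ^ 2 * m2 / 2) - (1 - c / q k)| = |m2 - v| * (t ^ 2 / 2) / q k := by
    have : (1 - (r⁻¹ * t) ^ 2 * m2 / 2) - (1 - c / q k) = -((m2 - v) * (t ^ 2 / 2 / q k)) := by
      rw [mul_pow, inv_pow, hss, hc]; field_simp; ring
    rw [this, abs_neg, abs_mul, abs_of_nonneg (a := t ^ 2 / 2 / q k) (by positivity)]
    ring
  have b3 : |w - (1 - c / q k)| ≤ (c / q k) ^ 2 := by
    have := Real.abs_exp_sub_one_sub_id_le (x := -(c / q k)) (by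
      rw [abs_neg, abs_of_nonneg (by positivity)]; exact (div_le_one hqpos).2 hqc)
    have e : w - (1 - c / q k) = Real.exp (-(c / q k)) - 1 - -(c / q k) := by
      simp only [w]; ring
    rw [e]; simpa using this
  have b : ‖φ - w‖ ≤ 4 * |r⁻¹ * t| ^ 3 * M + |m2 - v| * (t ^ 2 / 2) / q k + (c / q k) ^ 2 := by
    have e : φ - w = (φ - (1 - ((r⁻¹ * t : ℝ) : ℂ) ^ 2 * (m2 : ℝ) / 2)) +
      (((1 - (r⁻¹ * t) ^ 2 * m2 / 2) - (1 - c / q k) : ℝ) : ℂ) -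
      ((w - (1 - c / q k) : ℝ) : ℂ) := by push_cast; ring
    rw [e]
    refine (norm_sub_le _ _).trans (add_le_add ((norm_add_le _ _).trans (add_le_add b1 ?_)) ?_)
    · rw [Complex.norm_real, Real.norm_eq_abs, b2]
    · rwa [Complex.norm_real, Real.norm_eq_abs]
  refine (mul_le_mul_of_nonneg_left b hqpos.le).trans (le_of_eq ?_)
  rw [abs_mul, abs_of_pos (inv_pos.2 hsq)]
  rw [← hss]
  field_simp

/-- The law of the sum of `p` i.i.d. random variables with law `ν`. -/
noncomputable def iidSumLaw (ν : Measure ℝ) (p : ℕ) : Measure ℝ :=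
  (Measure.pi fun _ : Fin p => ν).map (fun x => ∑ i, x i)

instance (ν : Measure ℝ) [IsProbabilityMeasure ν] (p : ℕ) :
    IsProbabilityMeasure (iidSumLaw ν p) :=
  Measure.isProbabilityMeasure_map (by fun_prop)

lemma charFun_iidSumLaw (ν : Measure ℝ) [IsProbabilityMeasure ν] (p : ℕ) (t : ℝ) :
    charFun (iidSumLaw ν p) t = charFun ν t ^ p := by
  simp [iidSumLaw, charFun_map_sum_pi_eq_prod]

lemma iidSumLaw_zero_eq (ν ν' : Measure ℝ) [IsProbabilityMeasure ν] [IsProbabilityMeasure ν'] :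
    iidSumLaw ν 0 = iidSumLaw ν' 0 :=
  Measure.ext_of_charFun <| by ext t; simp [charFun_iidSumLaw]

lemma iidSumLaw_succ (ν : Measure ℝ) [IsProbabilityMeasure ν] (p : ℕ) :
    iidSumLaw ν (p + 1) = ν.conv (iidSumLaw ν p) :=
  Measure.ext_of_charFun <| by ext t; simp [charFun_iidSumLaw, charFun_conv, pow_succ']

instance nullSingletonClass_iidSumLaw_succ (ν : Measure ℝ) [IsProbabilityMeasure ν]
    [NullSingletonClass ν] (p : ℕ) : NullSingletonClass (iidSumLaw ν (p + 1)) where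
  measure_singleton x := by
    rw [iidSumLaw_succ, Measure.conv, Measure.map_apply (by fun_prop) (measurableSet_singleton x),
      Measure.prod_apply_symm (measurableSet_singleton x |>.preimage (by fun_prop))]
    refine lintegral_eq_zero_of_ae_eq_zero (ae_of_all _ fun y => ?_)
    have : (fun a : ℝ => (a, y)) ⁻¹' ((fun z : ℝ × ℝ => z.1 + z.2) ⁻¹' {x}) = {x - y} := by
      ext a; simp [eq_sub_iff_add_eq]
    simp only [this, measure_singleton, Pi.zero_apply]

lemma charFun_map_inv_sqrt_mul_sub_iidSumLaw (ν : Measure ℝ) [IsProbabilityMeasure ν]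
    (p : ℕ) (t : ℝ) :
    charFun ((iidSumLaw ν p).map (fun x => (√p)⁻¹ * (x + -p))) t =
      charFun (ν.map (fun x => x + -1)) ((√p)⁻¹ * t) ^ p := by
  have : (fun x : ℝ => (√p)⁻¹ * (x + -p)) = (fun x => (√p)⁻¹ * x) ∘ (fun x => x + -p) := rfl
  rw [this, ← Measure.map_map (by fun_prop) (by fun_prop), charFun_map_mul,
    charFun_map_add_const, charFun_map_add_const, charFun_iidSumLaw, mul_pow, ← Complex.exp_nat_mul]
  congr 2
  simp
  ring

/-- A triangular array of row laws with unit mean, convergent variance and bounded third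
central moment. -/
structure IsLyapunovArray (ν : ℕ → Measure ℝ) (v M : ℝ) : Prop where
  isProbabilityMeasure : ∀ k, IsProbabilityMeasure (ν k)
  integrable_thirdMoment : ∀ k, Integrable (fun x : ℝ => |x - 1| ^ 3) (ν k)
  thirdMoment_le : ∀ k, ∫ x, |x - 1| ^ 3 ∂(ν k) ≤ M
  integral_sub_one : ∀ k, ∫ x, (x - 1) ∂(ν k) = 0
  tendsto_variance : Tendsto (fun k => ∫ x, (x - 1) ^ 2 ∂(ν k)) atTop (nhds v)

lemma IsLyapunovArray.comp {ν : ℕ → Measure ℝ} {v M : ℝ} (h : IsLyapunovArray ν v M)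
    {φ : ℕ → ℕ} (hφ : Tendsto φ atTop atTop) : IsLyapunovArray (fun k => ν (φ k)) v M where
  isProbabilityMeasure _ := h.isProbabilityMeasure _
  integrable_thirdMoment _ := h.integrable_thirdMoment _
  thirdMoment_le _ := h.thirdMoment_le _
  integral_sub_one _ := h.integral_sub_one _
  tendsto_variance := h.tendsto_variance.comp hφ

lemma IsLyapunovArray.tendstoUniformly_cdf {ν : ℕ → Measure ℝ} {v : NNReal} {M : ℝ}
    (h : IsLyapunovArray ν v M) (hv : v ≠ 0) {q : ℕ → ℕ} (hq : Tendsto q atTop atTop) :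
    TendstoUniformly
      (fun k => (cdf ((iidSumLaw (ν k) (q k)).map (fun x => (√(q k))⁻¹ * (x + -q k))) : ℝ → ℝ))
      (cdf (gaussianReal 0 v)) atTop := by
  have := h.isProbabilityMeasure
  have hprob k : IsProbabilityMeasure
      ((iidSumLaw (ν k) (q k)).map (fun x => (√(q k))⁻¹ * (x + -q k))) :=
    Measure.isProbabilityMeasure_map (by fun_prop)
  have hprob' k : IsProbabilityMeasure ((ν k).map (fun x => x + -1)) :=
    Measure.isProbabilityMeasure_map (by fun_prop)
  have hnull : NullSingletonClass (gaussianReal 0 v) := nullSingletonClass_gaussianReal hv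
  refine _root_.tendstoUniformly_cdf (μ := fun k => ⟨_, hprob k⟩)
    (ν := ⟨gaussianReal 0 v, inferInstance⟩) (hν := hnull) ?_
  refine ProbabilityMeasure.tendsto_of_tendsto_charFun fun t => ?_
  simp only [ProbabilityMeasure.coe_mk, charFun_map_inv_sqrt_mul_sub_iidSumLaw, charFun_gaussianReal]
  have key := tendsto_charFun_pow_of_thirdMoment_le (μ := fun k => (ν k).map (fun x => x + -1))
    (v := v) (M := M) hq (fun k => ?_) (fun k => ?_) (fun k => ?_) v.2 ?_ t
  · convert key using 2
    push_cast
    congr 1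
    ring
  · rw [integrable_map_measure (by fun_prop) (by fun_prop)]
    exact h.integrable_thirdMoment k
  · rw [integral_map (by fun_prop) (by fun_prop)]
    exact h.thirdMoment_le k
  · rw [integral_map (by fun_prop) (by fun_prop)]
    exact h.integral_sub_one k
  · refine h.tendsto_variance.congr fun k => ?_
    rw [integral_map (by fun_prop) (by fun_prop)]
    rfl

lemma cdf_map_inv_sqrt_mul_sub (μ : Measure ℝ) [IsProbabilityMeasure μ] {p : ℕ} (hp : 0 < p)
    (r : ℝ) : cdf (μ.map (fun x => (√p)⁻¹ * (x + -p))) ((√p)⁻¹ * (r + -p)) = cdf μ r := by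
  have : IsProbabilityMeasure (μ.map (fun x => (√p)⁻¹ * (x + -p))) :=
    Measure.isProbabilityMeasure_map (by fun_prop)
  have hpos : 0 < (√(p : ℝ))⁻¹ := by positivity
  rw [cdf_eq_real, cdf_eq_real, map_measureReal_apply (by fun_prop) measurableSet_Iic]
  congr 1
  ext x
  simp [mul_le_mul_iff_right₀ hpos]

lemma IsLyapunovArray.eventually_abs_cdf_sub_lt {ν ν' : ℕ → Measure ℝ} {v : NNReal} {M M' : ℝ}
    (h : IsLyapunovArray ν v M) (h' : IsLyapunovArray ν' v M') (hv : v ≠ 0) {q : ℕ → ℕ}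
    (hq : Tendsto q atTop atTop) {ε : ℝ} (hε : 0 < ε) :
    ∀ᶠ k in atTop, ∀ r,
      |cdf (iidSumLaw (ν k) (q k)) r - cdf (iidSumLaw (ν' k) (q k)) r| < ε := by
  have := h.isProbabilityMeasure
  have := h'.isProbabilityMeasure
  filter_upwards [Metric.tendstoUniformly_iff.1 (h.tendstoUniformly_cdf hv hq) _ (half_pos hε),
    Metric.tendstoUniformly_iff.1 (h'.tendstoUniformly_cdf hv hq) _ (half_pos hε),
    hq.eventually_gt_atTop 0] with k h1 h2 hpos r
  rw [← cdf_map_inv_sqrt_mul_sub (iidSumLaw (ν k) (q k)) hpos,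
    ← cdf_map_inv_sqrt_mul_sub (iidSumLaw (ν' k) (q k)) hpos, ← Real.dist_eq]
  refine (dist_triangle_left _ _ (cdf (gaussianReal 0 v) ((√(q k))⁻¹ * (r + -q k)))).trans_lt ?_
  have := add_lt_add (h1 ((√(q k))⁻¹ * (r + -q k))) (h2 ((√(q k))⁻¹ * (r + -q k)))
  linarith

lemma eventually_abs_cdf_iidSumLaw_sub_lt {ν : ℕ → ProbabilityMeasure ℝ} {ν₀ : ProbabilityMeasure ℝ}
    [NullSingletonClass (ν₀ : Measure ℝ)] (h : Tendsto ν atTop (nhds ν₀)) (m : ℕ) {ε : ℝ}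
    (hε : 0 < ε) :
    ∀ᶠ k in atTop, ∀ r, |cdf (iidSumLaw (ν k) m) r - cdf (iidSumLaw ν₀ m) r| < ε := by
  cases m with
  | zero =>
    refine Eventually.of_forall fun k r => ?_
    rw [iidSumLaw_zero_eq (ν k) ν₀]
    simpa using hε
  | succ m =>
    have hS := tendstoUniformly_cdf
      (μ := fun k => ⟨iidSumLaw (ν k) (m + 1), inferInstance⟩)
      (ν := ⟨iidSumLaw ν₀ (m + 1), inferInstance⟩)
      (hν := nullSingletonClass_iidSumLaw_succ (ν₀ : Measure ℝ) m)
      (ProbabilityMeasure.tendsto_of_tendsto_charFun fun t => by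
        simpa only [ProbabilityMeasure.coe_mk, charFun_iidSumLaw] using
          (ProbabilityMeasure.tendsto_iff_tendsto_charFun.1 h t).pow (m + 1))
    filter_upwards [Metric.tendstoUniformly_iff.1 hS _ hε] with k hk r
    rw [← Real.dist_eq, dist_comm]
    exact hk r

lemma isLyapunovArray_map_sq {ρ : ℕ → Measure ℝ} (hρ : ∀ k, IsProbabilityMeasure (ρ k)) {v C : ℝ}
    (hint : ∀ k, Integrable (fun x : ℝ => x ^ 6) (ρ k)) (h2 : ∀ k, ∫ x, x ^ 2 ∂(ρ k) = 1)
    (h4 : Tendsto (fun k => ∫ x, x ^ 4 ∂(ρ k)) atTop (nhds (v + 1)))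
    (h6 : ∀ k, ∫ x, x ^ 6 ∂(ρ k) ≤ C) :
    IsLyapunovArray (fun k => (ρ k).map (fun x => x ^ 2)) v (C + 1) := by
  have hle (x : ℝ) : |x ^ 2 - 1| ^ 3 ≤ x ^ 6 + 1 := by
    have hx : 0 ≤ x ^ 2 := sq_nonneg x
    rcases le_total 1 (x ^ 2) with h | h
    · rw [abs_of_nonneg (by linarith)]
      have := pow_le_pow_left₀ (by linarith : 0 ≤ x ^ 2 - 1) (by linarith : x ^ 2 - 1 ≤ x ^ 2) 3
      nlinarith
    · rw [abs_of_nonpos (by linarith)]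
      have := pow_le_one₀ (by linarith : 0 ≤ -(x ^ 2 - 1)) (by linarith) (n := 3)
      have : 0 ≤ x ^ 6 := by positivity
      linarith
  have int6 k : Integrable (fun x : ℝ => x ^ 6 + 1) (ρ k) := (hint k).add (integrable_const _)
  have int3 k : Integrable (fun x : ℝ => |x ^ 2 - 1| ^ 3) (ρ k) :=
    (int6 k).mono' (by fun_prop) (ae_of_all _ fun x => by simpa using hle x)
  have int4 k : Integrable (fun x : ℝ => x ^ 4) (ρ k) := by
    refine (int6 k).mono' (by fun_prop) (ae_of_all _ fun x => ?_)
    rw [Real.norm_of_nonneg (by positivity)]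
    nlinarith [sq_nonneg (x ^ 3 - x), sq_nonneg (x ^ 2 - 1), sq_nonneg x,
      mul_nonneg (sq_nonneg (x ^ 2 - 1)) (sq_nonneg x)]
  have int2 k : Integrable (fun x : ℝ => x ^ 2) (ρ k) := by
    refine ((int4 k).add (integrable_const 1)).mono' (by fun_prop) (ae_of_all _ fun x => ?_)
    rw [Real.norm_of_nonneg (by positivity), Pi.add_apply]
    nlinarith [sq_nonneg (x ^ 2 - 1)]
  refine ⟨fun k => Measure.isProbabilityMeasure_map (by fun_prop), fun k => ?_, fun k => ?_,
    fun k => ?_, ?_⟩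
  · rw [integrable_map_measure (by fun_prop) (by fun_prop)]
    exact int3 k
  · rw [integral_map (by fun_prop) (by fun_prop)]
    refine (integral_mono (int3 k) (int6 k) hle).trans ?_
    rw [integral_add (hint k) (integrable_const _)]
    simpa using h6 k
  · rw [integral_map (by fun_prop) (by fun_prop), integral_sub (int2 k) (integrable_const _), h2]
    simp
  · have e (k : ℕ) : ∫ x, (x - 1) ^ 2 ∂((ρ k).map (fun x => x ^ 2)) = ∫ x, x ^ 4 ∂(ρ k) - 1 := by
      rw [integral_map (by fun_prop) (by fun_prop)]
      have : ∀ x : ℝ, (x ^ 2 - 1) ^ 2 = x ^ 4 - 2 * x ^ 2 + 1 := fun x => by ring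
      simp_rw [this]
      have hsub : Integrable (fun x : ℝ => x ^ 4 - 2 * x ^ 2) (ρ k) :=
        (int4 k).sub ((int2 k).const_mul 2)
      rw [integral_add hsub (integrable_const _), integral_sub (int4 k) ((int2 k).const_mul _),
        integral_const_mul, h2]
      simp
      ring
    simp_rw [e]
    simpa using h4.sub_const 1

lemma integral_pow_gaussianReal_eq_iteratedDeriv (n : ℕ) :
    ∫ x, x ^ n ∂(gaussianReal 0 1) = iteratedDeriv n (fun t => Real.exp (t ^ 2 / 2)) 0 := by
  have := iteratedDeriv_mgf_zero (X := fun x : ℝ => x) (μ := gaussianReal 0 1) (by simp) n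
  rw [mgf_fun_id_gaussianReal] at this
  simpa using this.symm

lemma deriv_mul_exp_sq_div_two {g g' : ℝ → ℝ} (hg : ∀ t, HasDerivAt g (g' t) t) :
    deriv (fun t => g t * Real.exp (t ^ 2 / 2)) =
      fun t => (g' t + t * g t) * Real.exp (t ^ 2 / 2) := by
  ext t
  have h1 : HasDerivAt (fun t : ℝ => t ^ 2 / 2) t t := by
    refine ((hasDerivAt_pow 2 t).div_const 2).congr_deriv ?_
    norm_num
  rw [((hg t).fun_mul h1.exp).deriv]
  ring

lemma iteratedDeriv_two_exp_sq_div_two :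
    iteratedDeriv 2 (fun t : ℝ => Real.exp (t ^ 2 / 2)) =
      fun t => (1 + t ^ 2) * Real.exp (t ^ 2 / 2) := by
  have h1 := deriv_mul_exp_sq_div_two (g := fun _ => 1) (g' := fun _ => 0)
    fun t => hasDerivAt_const t 1
  have h2 := deriv_mul_exp_sq_div_two (g := fun t => t) (g' := fun _ => 1) hasDerivAt_id'
  simp only [one_mul, zero_add, mul_one] at h1
  rw [iteratedDeriv_succ, iteratedDeriv_one, h1, h2]
  ext t; ring

lemma integral_sq_gaussianReal : ∫ x, x ^ 2 ∂(gaussianReal 0 1) = 1 := by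
  rw [integral_pow_gaussianReal_eq_iteratedDeriv, iteratedDeriv_two_exp_sq_div_two]
  simp

lemma integral_pow_four_gaussianReal : ∫ x, x ^ 4 ∂(gaussianReal 0 1) = 3 := by
  have h3 := deriv_mul_exp_sq_div_two (g := fun t => 1 + t ^ 2) (g' := fun t => 2 * t) fun t => by
    simpa using (hasDerivAt_pow 2 t).const_add 1
  have h4 := deriv_mul_exp_sq_div_two (g := fun t => 2 * t + t * (1 + t ^ 2))
    (g' := fun t => 3 + 3 * t ^ 2) fun t => by
      refine (((hasDerivAt_id' t).const_mul 2).fun_add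
        ((hasDerivAt_id' t).fun_mul ((hasDerivAt_pow 2 t).const_add 1))).congr_deriv ?_
      push_cast
      ring
  rw [integral_pow_gaussianReal_eq_iteratedDeriv, iteratedDeriv_succ, iteratedDeriv_succ,
    iteratedDeriv_two_exp_sq_div_two, h3, h4]
  simp

lemma isLyapunovArray_gaussianReal_map_sq :
    IsLyapunovArray (fun _ => (gaussianReal 0 1).map (fun x => x ^ 2)) 2
      (∫ x, x ^ 6 ∂(gaussianReal 0 1) + 1) := by
  refine isLyapunovArray_map_sq (fun _ => inferInstance) (fun _ => ?_)
    (fun _ => integral_sq_gaussianReal) ?_ fun _ => le_rfl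
  · have := (memLp_id_gaussianReal (μ := 0) (v := 1) 6).integrable_norm_pow (by norm_num)
    refine this.congr (ae_of_all _ fun x => ?_)
    simp [Even.pow_abs (by decide : Even 6)]
  · rw [integral_pow_four_gaussianReal]
    norm_num

/-- The unnormalised expectation of `f` at the `n`-step simple random walk. -/
def walkSum {R : Type*} [CommSemiring R] (f : ℝ → R) (n : ℕ) : R :=
  ∑ ij ∈ Finset.HasAntidiagonal.antidiagonal n, (n.choose ij.1 : R) * f (ij.1 - ij.2)

lemma walkSum_succ {R : Type*} [CommSemiring R] (f : ℝ → R) (n : ℕ) :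
    walkSum f (n + 1) = walkSum (fun x => f (x + 1) + f (x - 1)) n := by
  have := Finset.sum_antidiagonal_choose_succ_mul (R := R) (fun i j => f ((i : ℝ) - j)) n
  rw [walkSum, this, walkSum, ← Finset.sum_add_distrib]
  refine Finset.sum_congr rfl fun ij h => ?_
  rw [← Finset.HasAntidiagonal.mem_antidiagonal.1 h, Nat.choose_symm_add, mul_add, add_comm]
  push_cast
  congr 3 <;> ring

lemma walkSum_add {R : Type*} [CommSemiring R] (f g : ℝ → R) (n : ℕ) :
    walkSum (fun x => f x + g x) n = walkSum f n + walkSum g n := by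
  simp [walkSum, mul_add, Finset.sum_add_distrib]

lemma walkSum_const_mul {R : Type*} [CommSemiring R] (c : R) (f : ℝ → R) (n : ℕ) :
    walkSum (fun x => c * f x) n = c * walkSum f n := by
  simp [walkSum, Finset.mul_sum, mul_left_comm]

lemma walkSum_one (n : ℕ) : walkSum (fun _ => (1 : ℝ)) n = 2 ^ n := by
  induction n with
  | zero => simp [walkSum]
  | succ n ih =>
    have := walkSum_const_mul (2 : ℝ) (fun _ => 1) n
    rw [walkSum_succ, pow_succ', ← ih, ← this]
    norm_num

lemma walkSum_sq (n : ℕ) : walkSum (fun x => x ^ 2) n = n * 2 ^ n := by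
  induction n with
  | zero => simp [walkSum]
  | succ n ih =>
    have e : (fun x : ℝ => (x + 1) ^ 2 + (x - 1) ^ 2) = fun x => 2 * x ^ 2 + 2 * 1 := by
      ext x; ring
    rw [walkSum_succ, e, walkSum_add, walkSum_const_mul, walkSum_const_mul, ih, walkSum_one]
    push_cast; ring

lemma walkSum_pow_four (n : ℕ) : walkSum (fun x => x ^ 4) n = (3 * n ^ 2 - 2 * n) * 2 ^ n := by
  induction n with
  | zero => simp [walkSum]
  | succ n ih =>
    have e : (fun x : ℝ => (x + 1) ^ 4 + (x - 1) ^ 4) =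
        fun x => (2 * x ^ 4 + 12 * x ^ 2) + 2 * 1 := by
      ext x; ring
    rw [walkSum_succ, e, walkSum_add, walkSum_add, walkSum_const_mul, walkSum_const_mul,
      walkSum_const_mul, ih, walkSum_sq, walkSum_one]
    push_cast; ring

lemma walkSum_pow_six (n : ℕ) :
    walkSum (fun x => x ^ 6) n = (15 * n ^ 3 - 30 * n ^ 2 + 16 * n) * 2 ^ n := by
  induction n with
  | zero => simp [walkSum]
  | succ n ih =>
    have e : (fun x : ℝ => (x + 1) ^ 6 + (x - 1) ^ 6) =
        fun x => ((2 * x ^ 6 + 30 * x ^ 4) + 30 * x ^ 2) + 2 * 1 := by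
      ext x; ring
    rw [walkSum_succ, e, walkSum_add, walkSum_add, walkSum_add, walkSum_const_mul,
      walkSum_const_mul, walkSum_const_mul, walkSum_const_mul, ih, walkSum_pow_four, walkSum_sq,
      walkSum_one]
    push_cast; ring

lemma walkSum_cexp (s : ℝ) (n : ℕ) :
    walkSum (fun x => Complex.exp (s * x * Complex.I)) n = (2 * Complex.cos s) ^ n := by
  induction n with
  | zero => simp [walkSum]
  | succ n ih =>
    have e : (fun x : ℝ => Complex.exp (s * (x + 1 : ℝ) * Complex.I) +
        Complex.exp (s * (x - 1 : ℝ) * Complex.I)) =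
        fun x : ℝ => (2 * Complex.cos s) * Complex.exp (s * x * Complex.I) := by
      ext x
      rw [Complex.two_cos, add_mul, ← Complex.exp_add, ← Complex.exp_add]
      congr 2 <;> (push_cast; ring)
    rw [walkSum_succ, e, walkSum_const_mul, ih, pow_succ']

set_option linter.deprecated false in
/-- The law of the standardised `Binomial(n, 1/2)` random variable. -/
noncomputable def stdBinomial (n : ℕ) : Measure ℝ :=
  (PMF.binomial 2⁻¹ (by norm_num) n).toMeasure.map
    (fun i : Fin (n + 1) => 2 * √n * ((i : ℝ) / n - 1 / 2))

instance (n : ℕ) : IsProbabilityMeasure (stdBinomial n) :=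
  Measure.isProbabilityMeasure_map (Measurable.of_discrete).aemeasurable

set_option linter.deprecated false in
lemma integral_stdBinomial {𝕜 : Type*} [RCLike 𝕜] {n : ℕ} (hn : 0 < n) {f : ℝ → 𝕜}
    (hf : Continuous f) :
    ∫ x, f x ∂(stdBinomial n) = (2 ^ n)⁻¹ * walkSum (fun x => f (x / √n)) n := by
  rw [stdBinomial, integral_map (Measurable.of_discrete).aemeasurable hf.aestronglyMeasurable,
    PMF.integral_eq_sum, walkSum, Finset.Nat.sum_antidiagonal_eq_sum_range_succ_mk,
    Finset.sum_range, Finset.mul_sum]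
  refine Finset.sum_congr rfl fun i _ => ?_
  have hi : (i : ℕ) ≤ n := Nat.lt_succ_iff.1 i.2
  have hn' : (0 : ℝ) < n := by exact_mod_cast hn
  have h1 : 2 * √(n : ℝ) * ((i : ℝ) / n - 1 / 2) = ((i : ℝ) - (n - i : ℕ)) / √n := by
    have hs : √(n : ℝ) * √n = n := Real.mul_self_sqrt hn'.le
    have : 0 < √(n : ℝ) := Real.sqrt_pos.2 hn'
    rw [Nat.cast_sub hi, eq_div_iff this.ne']
    calc _ = 2 * (√(n : ℝ) * √n) * ((i : ℝ) / n - 1 / 2) := by ring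
      _ = _ := by rw [hs]; field_simp; ring
  have h3 : ((PMF.binomial 2⁻¹ (by norm_num) n) i).toReal = (2 ^ n)⁻¹ * (n.choose i : ℝ) := by
    have h2 : ((2⁻¹ : NNReal) : ENNReal) ^ (i : ℕ) *
        (1 - ((2⁻¹ : NNReal) : ENNReal)) ^ (n - (i : ℕ)) = (2 ^ n)⁻¹ := by
      rw [ENNReal.coe_inv two_ne_zero, ENNReal.coe_ofNat, ENNReal.one_sub_inv_two, ← pow_add,
        Nat.add_sub_cancel' hi, ENNReal.inv_pow]
    rw [PMF.binomial_apply, Fin.val_last, h2]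
    simp
  rw [h1, h3, RCLike.real_smul_eq_coe_mul]
  push_cast
  ring

lemma integrable_stdBinomial {n : ℕ} {f : ℝ → ℝ} (hf : Continuous f) :
    Integrable f (stdBinomial n) := by
  rw [stdBinomial, integrable_map_measure hf.aestronglyMeasurable
    (Measurable.of_discrete).aemeasurable]
  exact Integrable.of_finite

lemma integral_pow_stdBinomial {n : ℕ} (hn : 0 < n) (k : ℕ) :
    ∫ x, x ^ k ∂(stdBinomial n) = (2 ^ n * √n ^ k)⁻¹ * walkSum (fun x => x ^ k) n := by
  have e : (fun x : ℝ => (x / √n) ^ k) = fun x => (√n ^ k)⁻¹ * x ^ k := by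
    ext x; rw [div_pow, div_eq_inv_mul]
  rw [integral_stdBinomial hn (continuous_pow k), e, walkSum_const_mul, mul_inv, mul_assoc]

lemma integral_stdBinomial_one : ∫ x, x ∂(stdBinomial 1) = 0 := by
  rw [integral_stdBinomial one_pos continuous_id']
  simp [walkSum, Finset.Nat.sum_antidiagonal_eq_sum_range_succ_mk, Finset.sum_range_succ]

lemma integral_sq_stdBinomial {n : ℕ} (hn : 0 < n) : ∫ x, x ^ 2 ∂(stdBinomial n) = 1 := by
  rw [integral_pow_stdBinomial hn, walkSum_sq, Real.sq_sqrt n.cast_nonneg]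
  field_simp

lemma integral_pow_four_stdBinomial {n : ℕ} (hn : 0 < n) :
    ∫ x, x ^ 4 ∂(stdBinomial n) = 3 - 2 * (n : ℝ)⁻¹ := by
  have : √(n : ℝ) ^ 4 = n ^ 2 := by
    rw [show 4 = 2 * 2 from rfl, pow_mul, Real.sq_sqrt n.cast_nonneg]
  rw [integral_pow_stdBinomial hn, walkSum_pow_four, this]
  field_simp

lemma integral_pow_six_stdBinomial_le {n : ℕ} (hn : 0 < n) :
    ∫ x, x ^ 6 ∂(stdBinomial n) ≤ 15 := by
  have : √(n : ℝ) ^ 6 = n ^ 3 := by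
    rw [show 6 = 2 * 3 from rfl, pow_mul, Real.sq_sqrt n.cast_nonneg]
  rw [integral_pow_stdBinomial hn, walkSum_pow_six, this, ← div_eq_inv_mul,
    div_le_iff₀ (by positivity)]
  have h1 : (1 : ℝ) ≤ n := by exact_mod_cast hn
  have h2 : 15 * (n : ℝ) ^ 3 - 30 * n ^ 2 + 16 * n ≤ 15 * n ^ 3 := by nlinarith
  have := mul_le_mul_of_nonneg_right h2 (by positivity : (0 : ℝ) ≤ 2 ^ n)
  linarith

lemma isLyapunovArray_stdBinomial_map_sq :
    IsLyapunovArray (fun k => (stdBinomial (k + 1)).map (fun x => x ^ 2)) 2 (15 + 1) := by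
  refine isLyapunovArray_map_sq (fun _ => inferInstance)
    (fun _ => integrable_stdBinomial (by fun_prop))
    (fun k => integral_sq_stdBinomial k.succ_pos) ?_
    fun k => integral_pow_six_stdBinomial_le k.succ_pos
  simp_rw [integral_pow_four_stdBinomial (Nat.succ_pos _)]
  have := ((tendsto_add_atTop_iff_nat 1).2 (tendsto_inv_atTop_nhds_zero_nat (𝕜 := ℝ))).const_mul 2
  convert this.const_sub 3 using 2
  norm_num

lemma charFun_stdBinomial {n : ℕ} (hn : 0 < n) (t : ℝ) :
    charFun (stdBinomial n) t = Complex.cos ((√n)⁻¹ * t : ℝ) ^ n := by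
  have e : (fun x : ℝ => Complex.exp (t * (x / √n : ℝ) * Complex.I)) =
      fun x : ℝ => Complex.exp (((√n)⁻¹ * t : ℝ) * x * Complex.I) := by
    ext x; congr 2; push_cast; ring
  rw [charFun_apply_real, integral_stdBinomial (f := fun x : ℝ => Complex.exp (t * x * Complex.I))
    hn (by fun_prop), e, walkSum_cexp, mul_pow]
  exact inv_mul_cancel_left₀ (pow_ne_zero _ two_ne_zero) _

lemma tendsto_stdBinomial :
    Tendsto (β := ProbabilityMeasure ℝ) (fun k => ⟨stdBinomial (k + 1), inferInstance⟩) atTop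
      (nhds ⟨gaussianReal 0 1, inferInstance⟩) := by
  refine ProbabilityMeasure.tendsto_of_tendsto_charFun fun t => ?_
  have h := tendsto_charFun_pow_of_thirdMoment_le (μ := fun _ => stdBinomial 1) (v := 1)
    (tendsto_add_atTop_nat 1) (fun _ => integrable_stdBinomial (by fun_prop)) (fun _ => le_rfl)
    (fun _ => integral_stdBinomial_one) zero_le_one
    (by simp [integral_sq_stdBinomial one_pos]) t
  simp only [ProbabilityMeasure.coe_mk]
  convert h using 2 with k
  · rw [charFun_stdBinomial k.succ_pos, charFun_stdBinomial one_pos]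
    simp
  · rw [charFun_gaussianReal]
    push_cast
    congr 1
    simp

instance : NullSingletonClass ((gaussianReal 0 1).map (fun x => x ^ 2)) where
  measure_singleton x := by
    have := nullSingletonClass_gaussianReal (μ := 0) (one_ne_zero (α := NNReal))
    rw [Measure.map_apply (by fun_prop) (measurableSet_singleton x)]
    refine Set.Countable.measure_zero (Set.Finite.countable ?_) _
    refine (Set.toFinite {√x, -√x}).subset fun y hy => ?_
    have hy : y ^ 2 = x := hy
    rw [← hy, Real.sqrt_sq_eq_abs]
    rcases abs_choice y with h | h <;> simp [h]

lemma map_sum_sq_pi_eq_iidSumLaw (μ : Measure ℝ) [IsProbabilityMeasure μ] (p : ℕ) :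
    (Measure.pi fun _ : Fin p => μ).map (fun z => ∑ i, z i ^ 2) =
      iidSumLaw (μ.map (fun x => x ^ 2)) p := by
  have : IsProbabilityMeasure (μ.map (fun x => x ^ 2)) :=
    Measure.isProbabilityMeasure_map (by fun_prop)
  rw [iidSumLaw, ← Measure.pi_map_pi (fun _ => by fun_prop),
    Measure.map_map (by fun_prop) (by fun_prop)]
  rfl

lemma chiSqMeasure_Iic_toReal (p : ℕ) (r : ℝ) :
    (chiSqMeasure p (Set.Iic r)).toReal =
      cdf (iidSumLaw ((gaussianReal 0 1).map (fun x => x ^ 2)) p) r := by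
  have : IsProbabilityMeasure ((gaussianReal 0 1).map (fun x : ℝ => x ^ 2)) :=
    Measure.isProbabilityMeasure_map (by fun_prop)
  rw [cdf_eq_real, Measure.real, chiSqMeasure, map_sum_sq_pi_eq_iidSumLaw]

lemma binomialPi_sum_sq_le_toReal (n p : ℕ) (r : ℝ) :
    ((binomialPi n p) {t : Fin p → Fin (n + 1) |
        ∑ j, (2 * Real.sqrt n * ((t j : ℝ) / n - 1 / 2)) ^ 2 ≤ r}).toReal =
      cdf (iidSumLaw ((stdBinomial n).map (fun x => x ^ 2)) p) r := by
  have : IsProbabilityMeasure ((stdBinomial n).map (fun x : ℝ => x ^ 2)) :=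
    Measure.isProbabilityMeasure_map (by fun_prop)
  rw [cdf_eq_real, Measure.real, ← map_sum_sq_pi_eq_iidSumLaw, stdBinomial,
    ← Measure.pi_map_pi (fun _ => (Measurable.of_discrete).aemeasurable),
    Measure.map_map (by fun_prop) (Measurable.of_discrete),
    Measure.map_apply (Measurable.of_discrete) measurableSet_Iic]
  rfl

lemma forall_eventually_abs_cdf_stdBinomial_sub_lt (m : ℕ) {ε : ℝ} (hε : 0 < ε) :
    ∀ᶠ k in atTop, ∀ r, |cdf (iidSumLaw ((stdBinomial (k + 1)).map (fun x => x ^ 2)) m) r -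
      cdf (iidSumLaw ((gaussianReal 0 1).map (fun x => x ^ 2)) m) r| < ε := by
  have hf : Continuous fun x : ℝ => x ^ 2 := continuous_pow 2
  have h := ProbabilityMeasure.tendsto_map_of_tendsto_of_continuous _ _ tendsto_stdBinomial hf
  have : NullSingletonClass ((ProbabilityMeasure.map ⟨gaussianReal 0 1, inferInstance⟩
      hf.aemeasurable : ProbabilityMeasure ℝ) : Measure ℝ) :=
    inferInstanceAs (NullSingletonClass ((gaussianReal 0 1).map (fun x => x ^ 2)))
  exact eventually_abs_cdf_iidSumLaw_sub_lt h m hε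

/-- An eventual statement about a sequence `p` of naturals holds as soon as it holds along
subsequences where `p` is constant and along those where `p` diverges. -/
lemma eventually_of_const_of_tendsto_atTop {P : ℕ → Prop} (p : ℕ → ℕ)
    (hc : ∀ m, ∀ᶠ n in atTop, p n = m → P n)
    (ht : ∀ φ : ℕ → ℕ, Tendsto φ atTop atTop → Tendsto (p ∘ φ) atTop atTop →
      ∀ᶠ k in atTop, P (φ k)) :
    ∀ᶠ n in atTop, P n := by
  by_contra h
  obtain ⟨φ, hφ, hbad⟩ := extraction_of_frequently_atTop (not_eventually.1 h)
  have hp : Tendsto (p ∘ φ) atTop atTop := by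
    rw [tendsto_atTop]
    intro M
    have := (eventually_all_finset (Finset.range M)).2 fun m _ => hφ.tendsto_atTop.eventually (hc m)
    filter_upwards [this] with k hk
    by_contra! hlt
    exact hbad k (hk _ (Finset.mem_range.2 hlt) rfl)
  obtain ⟨k, hk⟩ := (ht φ hφ.tendsto_atTop hp).exists
  exact hbad k hk

/-- **High-dimensional chi-square approximation.** If `T_1, …, T_p` are i.i.d.
`Binomial(n, 1/2)` and `p = p(n) = o(n^{2/7})`, then
`sup_{r ≥ 0} |P(∑_j (2√n (T_j/n - 1/2))² ≤ r) - P(χ²_p ≤ r)| → 0` as `n → ∞`. -/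
theorem chi_square_convergence_high_dim (p : ℕ → ℕ)
    (hp : Asymptotics.IsLittleO atTop (fun n : ℕ => (p n : ℝ))
      (fun n : ℕ => (n : ℝ) ^ ((2 : ℝ) / 7))) :
    Tendsto (fun n : ℕ =>
      ⨆ r : Set.Ici (0 : ℝ),
        |((binomialPi n (p n))
            {t : Fin (p n) → Fin (n + 1) |
              ∑ j, (2 * Real.sqrt n * ((t j : ℝ) / n - 1 / 2)) ^ 2 ≤ (r : ℝ)}).toReal -
          ((chiSqMeasure (p n)) (Set.Iic (r : ℝ))).toReal|)
      atTop (nhds 0) := by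
  simp_rw [binomialPi_sum_sq_le_toReal, chiSqMeasure_Iic_toReal]
  rw [← tendsto_add_atTop_iff_nat 1, Metric.tendsto_nhds]
  intro ε hε
  have key : ∀ᶠ n in atTop, ∀ r,
      |cdf (iidSumLaw ((stdBinomial (n + 1)).map (fun x => x ^ 2)) (p (n + 1))) r -
        cdf (iidSumLaw ((gaussianReal 0 1).map (fun x => x ^ 2)) (p (n + 1))) r| < ε / 2 := by
    refine eventually_of_const_of_tendsto_atTop (fun n => p (n + 1)) (fun m => ?_)
      fun φ hφ hpφ => ?_
    · filter_upwards [forall_eventually_abs_cdf_stdBinomial_sub_lt m (half_pos hε)] with n hn hm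
      rwa [hm]
    · exact (isLyapunovArray_stdBinomial_map_sq.comp hφ).eventually_abs_cdf_sub_lt
        (v := 2) isLyapunovArray_gaussianReal_map_sq two_ne_zero hpφ (half_pos hε)
  filter_upwards [key] with n hn
  rw [Real.dist_0_eq_abs, abs_of_nonneg (Real.iSup_nonneg fun _ => abs_nonneg _)]
  exact (Real.iSup_le (fun r : Set.Ici (0 : ℝ) => (hn r).le) (half_pos hε).le).trans_lt
    (half_lt_self hε)
end
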